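/- For every c ∈ ℝ, every integer l ≥ 1 and every integer k ≥ 2, one has (M(c + 1/2; l, k−1) ⊎ M(c − 1/2; l, k+1))^# = M(c + 1/2; k−1, l) ⊎ M(c − 1/2; k+1, l), where ⊎ denotes multiset union. (This is the combinatorial content, via the Moeglin–Waldspurger algorithm, of the statement that the dual of the Langlands quotient of u(Z(ρ,l),k−1) × u(Z(ρ,l),k+1) is the Langlands quotient of u(Z(ρ,k−1),l) × u(Z(ρ,k+1),l).) -/

import Mathlib

open scoped Classical

noncomputable section

/-- The segment `{a, a+1, ..., a+m-1}` as a finite set of reals. -/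
def finsetSeg (a : ℝ) (m : ℕ) : Finset ℝ :=
  (Finset.range m).image (fun i => a + i)

/-- A segment is a nonempty subset of `ℝ` of the form `{a, a+1, ..., a+m-1}` with `m ≥ 1`. -/
def IsSegment (S : Finset ℝ) : Prop :=
  ∃ (a : ℝ) (m : ℕ), 1 ≤ m ∧ S = finsetSeg a m

/-- A multisegment is a nonempty finite multiset of segments. -/
def IsMultisegment (M : Multiset (Finset ℝ)) : Prop :=
  M ≠ 0 ∧ ∀ S ∈ M, IsSegment S

/-- The beginning (smallest element) of a segment. -/
def beg (S : Finset ℝ) : ℝ := if h : S.Nonempty then S.min' h else 0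

/-- The ending (largest element) of a segment. -/
def endg (S : Finset ℝ) : ℝ := if h : S.Nonempty then S.max' h else 0

/-- Two segments are linked if neither is included in the other and their union is a segment. -/
def Linked (S₁ S₂ : Finset ℝ) : Prop :=
  ¬ S₁ ⊆ S₂ ∧ ¬ S₂ ⊆ S₁ ∧ IsSegment (S₁ ∪ S₂)

/-- `ElemOp M N` means that `N` is obtained from `M` by an elementary operation:
a pair of linked segments `S₁, S₂` of `M` is replaced by `S₁ ∪ S₂, S₁ ∩ S₂`,
the intersection being omitted when empty. -/
def ElemOp (M N : Multiset (Finset ℝ)) : Prop :=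
  ∃ (S₁ S₂ : Finset ℝ) (rest : Multiset (Finset ℝ)),
    Linked S₁ S₂ ∧ M = S₁ ::ₘ S₂ ::ₘ rest ∧
    N = (if S₁ ∩ S₂ = ∅ then (S₁ ∪ S₂) ::ₘ rest
         else (S₁ ∪ S₂) ::ₘ (S₁ ∩ S₂) ::ₘ rest)

/-- `msLE M M'` (i.e. `M ≤ M'`) : `M` is obtained from `M'` by a finite (possibly empty)
sequence of elementary operations. -/
def msLE (M M' : Multiset (Finset ℝ)) : Prop :=
  Relation.ReflTransGen ElemOp M' M

/-- The support of a multisegment: the multiset union of its segments. -/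
def suppM (M : Multiset (Finset ℝ)) : Multiset ℝ :=
  (M.map Finset.val).sum

/-- The maxlength `m(M)`: the maximal length of the segments of `M`. -/
def maxLen (M : Multiset (Finset ℝ)) : ℕ :=
  (M.map Finset.card).sup

/-- The thickness `t(M)`: the number of segments of `M`, counted with multiplicity. -/
def thickness (M : Multiset (Finset ℝ)) : ℕ := Multiset.card M

/-- The largest element of `E(M)`, the multiset of endings of the segments of `M`. -/
def maxEnd (M : Multiset (Finset ℝ)) : ℝ :=
  ((M.map endg).toFinset.max).unbotD 0

/-- The candidate segments of `M` with ending `x` which are not included in `prev`. -/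
def cands (M : Multiset (Finset ℝ)) (x : ℝ) (prev : Finset ℝ) : Finset (Finset ℝ) :=
  M.toFinset.filter (fun S => endg S = x ∧ ¬ S ⊆ prev)

/-- A shortest element of a finite collection of finite sets (junk value `∅` if empty).
In the Moeglin-Waldspurger algorithm the candidate sets consist of segments with a
common ending, so a shortest candidate is unique and this choice is canonical. -/
def chooseMin (C : Finset (Finset ℝ)) : Finset ℝ :=
  if h : C.Nonempty then (Finset.exists_min_image C Finset.card h).choose else ∅

/-- The chain `δ₀, δ₁, δ₂, ...` of the Moeglin-Waldspurger algorithm: `δ₀` is a shortest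
segment of `M` with ending `x` (the maximal ending), and `δ_i` is a shortest segment of
`M` with ending `x - i` not included in `δ_{i-1}`; the construction stops when no such
segment exists.  The first argument is fuel (the chain has length at most `card M`). -/
def mwChainAux (M : Multiset (Finset ℝ)) : ℕ → ℝ → Finset ℝ → List (Finset ℝ)
  | 0, _, _ => []
  | n + 1, x, prev =>
      if (cands M x prev).Nonempty then
        chooseMin (cands M x prev) :: mwChainAux M n (x - 1) (chooseMin (cands M x prev))
      else []

/-- The chain `δ₀, δ₁, ..., δ_r` of the Moeglin-Waldspurger algorithm for `M`. -/
def mwChain (M : Multiset (Finset ℝ)) : List (Finset ℝ) :=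
  mwChainAux M (Multiset.card M) (maxEnd M) ∅

/-- The first segment `S₀ = {e-r, ..., e}` of `M^#`, where `e = maxEnd M` and
`r + 1` is the length of the chain. -/
def firstSeg (M : Multiset (Finset ℝ)) : Finset ℝ :=
  finsetSeg (maxEnd M - (((mwChain M).length - 1 : ℕ) : ℝ)) (mwChain M).length

/-- `δ⁻`: the segment `δ` with its ending removed. -/
def segMinus (S : Finset ℝ) : Finset ℝ := S.erase (endg S)

/-- `M⁻`: the multisegment obtained from `M` by replacing each `δ_i` of the chain by
`δ_i⁻`, erasing it if it becomes empty. -/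
def msMinus (M : Multiset (Finset ℝ)) : Multiset (Finset ℝ) :=
  (mwChain M).foldl
    (fun N δ => if segMinus δ = ∅ then N.erase δ else segMinus δ ::ₘ N.erase δ) M

/-- Fuelled version of the Moeglin-Waldspurger algorithm.  Each round extracts the first
segment `S₀` and recurses on `M⁻`; on a genuine multisegment each round strictly decreases
the cardinality of the support, so fuel `card (suppM M)` always suffices. -/
def mwaAux : ℕ → Multiset (Finset ℝ) → Multiset (Finset ℝ)
  | 0, _ => 0
  | n + 1, M => if M = 0 then 0 else firstSeg M ::ₘ mwaAux n (msMinus M)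

/-- The Moeglin-Waldspurger algorithm `M ↦ M^#`. -/
def mwa (M : Multiset (Finset ℝ)) : Multiset (Finset ℝ) :=
  mwaAux (Multiset.card (suppM M)) M

/-- The staircase multisegment `M(a; l, k)`: the `k` segments
`{a+i, a+i+1, ..., a+i+l-1}` for `i = 1, ..., k` (`k` segments of length `l`,
each a shift by `1` of the previous one). -/
def staircase (a : ℝ) (l k : ℕ) : Multiset (Finset ℝ) :=
  (Multiset.range k).map (fun i => finsetSeg (a + i + 1) l)

theorem mem_finsetSeg {a x : ℝ} {m : ℕ} : x ∈ finsetSeg a m ↔ ∃ i < m, a + (i : ℝ) = x := by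
  simp [finsetSeg, eq_neg_add_iff_add_eq]

theorem finsetSeg_eq_image (a : ℝ) (m : ℕ) :
    finsetSeg a m = (Finset.range m).image (fun i : ℕ => a + (i : ℝ)) := by
  ext x
  simp [mem_finsetSeg]

@[simp]
theorem finsetSeg_zero (a : ℝ) : finsetSeg a 0 = ∅ := by
  simp [finsetSeg]

theorem card_finsetSeg (a : ℝ) (m : ℕ) : (finsetSeg a m).card = m := by
  rw [finsetSeg_eq_image, Finset.card_image_of_injective, Finset.card_range]
  intro i j h
  simpa using h

theorem finsetSeg_nonempty (a : ℝ) {m : ℕ} (hm : 1 ≤ m) : (finsetSeg a m).Nonempty := by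
  rw [← Finset.card_pos, card_finsetSeg]
  exact hm

theorem endg_finsetSeg (a : ℝ) {m : ℕ} (hm : 1 ≤ m) : endg (finsetSeg a m) = a + m - 1 := by
  rw [endg, dif_pos (finsetSeg_nonempty a hm)]
  apply le_antisymm
  · apply Finset.max'_le
    intro y hy
    obtain ⟨i, hi, rfl⟩ := mem_finsetSeg.1 hy
    have : (i : ℝ) + 1 ≤ m := by exact_mod_cast hi
    linarith
  · apply Finset.le_max'
    refine mem_finsetSeg.2 ⟨m - 1, by omega, ?_⟩
    push_cast [Nat.cast_sub hm]
    ring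

theorem segMinus_finsetSeg_succ (a : ℝ) (m : ℕ) :
    segMinus (finsetSeg a (m + 1)) = finsetSeg a m := by
  rw [segMinus, endg_finsetSeg a (by omega)]
  ext x
  simp only [Finset.mem_erase, mem_finsetSeg]
  constructor
  · rintro ⟨hx, i, hi, rfl⟩
    refine ⟨i, ?_, rfl⟩
    have : i ≠ m := by
      rintro rfl
      apply hx
      push_cast
      ring
    omega
  · rintro ⟨i, hi, rfl⟩
    refine ⟨?_, i, by omega, rfl⟩
    have : (i : ℝ) < m := by exact_mod_cast hi
    push_cast
    intro h
    linarith

theorem finsetSeg_subset {a b : ℝ} {m n : ℕ} (d : ℕ) (hd : a = b + d) (h : d + m ≤ n) :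
    finsetSeg a m ⊆ finsetSeg b n := by
  intro x hx
  obtain ⟨i, hi, rfl⟩ := mem_finsetSeg.1 hx
  refine mem_finsetSeg.2 ⟨d + i, by omega, ?_⟩
  push_cast
  linarith

theorem finsetSeg_not_subset {a b : ℝ} {m n : ℕ} (hm : 1 ≤ m) (h : a < b) :
    ¬ finsetSeg a m ⊆ finsetSeg b n := by
  intro hs
  obtain ⟨i, -, hi⟩ := mem_finsetSeg.1 (hs (mem_finsetSeg.2 ⟨0, hm, rfl⟩))
  have : (0 : ℝ) ≤ i := i.cast_nonneg
  push_cast at hi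
  linarith

theorem staircase_succ (a : ℝ) (l k : ℕ) :
    staircase a l (k + 1) = finsetSeg (a + k + 1) l ::ₘ staircase a l k := by
  simp [staircase, Multiset.range_succ]

theorem mem_staircase {a : ℝ} {l k : ℕ} {T : Finset ℝ} :
    T ∈ staircase a l k ↔ ∃ i < k, finsetSeg (a + i + 1) l = T := by
  simp [staircase]

theorem card_staircase (a : ℝ) (l k : ℕ) : Multiset.card (staircase a l k) = k := by
  simp [staircase]

theorem suppM_add (M N : Multiset (Finset ℝ)) : suppM (M + N) = suppM M + suppM N := by
  simp [suppM]

theorem card_suppM_staircase (a : ℝ) (l k : ℕ) :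
    Multiset.card (suppM (staircase a l k)) = k * l := by
  induction k with
  | zero => simp [staircase, suppM]
  | succ k ih =>
    rw [staircase_succ, ← Multiset.singleton_add, suppM_add, Multiset.card_add, ih]
    simp [suppM, card_finsetSeg]
    ring

/-- The segments of a staircase, in decreasing order of their endings. -/
def descStair (b : ℝ) (m : ℕ) : ℕ → List (Finset ℝ)
  | 0 => []
  | r + 1 => finsetSeg (b + r + 1) m :: descStair b m r

theorem length_descStair (b : ℝ) (m r : ℕ) : (descStair b m r).length = r := by
  induction r with
  | zero => rfl
  | succ r ih => rw [descStair, List.length_cons, ih]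

/-- The segment chosen just before `finsetSeg (b + j) m` when the Moeglin-Waldspurger chain
runs down a staircase with `r` steps (`∅` at the start of the chain). -/
def prevSeg (b : ℝ) (m r j : ℕ) : Finset ℝ :=
  if j = r then ∅ else finsetSeg (b + j + 1) m

theorem mem_cands {M : Multiset (Finset ℝ)} {x : ℝ} {P S : Finset ℝ} :
    S ∈ cands M x P ↔ S ∈ M ∧ endg S = x ∧ ¬ S ⊆ P := by
  simp [cands]

theorem chooseMin_mem {C : Finset (Finset ℝ)} (h : C.Nonempty) : chooseMin C ∈ C := by
  rw [chooseMin, dif_pos h]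
  exact (Finset.exists_min_image C Finset.card h).choose_spec.1

theorem chooseMin_card_le {C : Finset (Finset ℝ)} {S : Finset ℝ} (hS : S ∈ C) :
    (chooseMin C).card ≤ S.card := by
  have h : C.Nonempty := ⟨S, hS⟩
  rw [chooseMin, dif_pos h]
  exact (Finset.exists_min_image C Finset.card h).choose_spec.2 S hS

/-- `N` does not interfere with the Moeglin-Waldspurger chain running down the
staircase `staircase b m r`. -/
structure NonInterfering (b : ℝ) (m r : ℕ) (N : Multiset (Finset ℝ)) : Prop where
  endg_le : ∀ T ∈ N, endg T ≤ b + r + m - 1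
  subset_or : ∀ T ∈ N, ∀ j ≤ r, endg T = b + j + m - 1 →
    T ⊆ prevSeg b m r j ∨ 1 ≤ j ∧ (m < T.card ∨ T = finsetSeg (b + j) m)

section Step

variable {b : ℝ} {m r : ℕ} {N : Multiset (Finset ℝ)}

theorem step_mem_cands (hm : 1 ≤ m) {j : ℕ} (hj : j + 1 ≤ r) :
    finsetSeg (b + j + 1) m ∈
      cands (staircase b m r + N) (b + (j + 1 : ℕ) + m - 1) (prevSeg b m r (j + 1)) := by
  refine mem_cands.2 ⟨Multiset.mem_add.2 (.inl (mem_staircase.2 ⟨j, by omega, rfl⟩)), ?_, ?_⟩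
  · rw [endg_finsetSeg _ hm]
    push_cast
    ring
  · unfold prevSeg
    split_ifs
    · rw [Finset.subset_empty]
      exact (finsetSeg_nonempty _ hm).ne_empty
    · apply finsetSeg_not_subset hm
      push_cast
      linarith

theorem chooseMin_cands (hm : 1 ≤ m) (hN : NonInterfering b m r N) {j : ℕ} (hj : j + 1 ≤ r) :
    chooseMin (cands (staircase b m r + N) (b + (j + 1 : ℕ) + m - 1) (prevSeg b m r (j + 1))) =
      finsetSeg (b + j + 1) m := by
  have hmem := step_mem_cands (b := b) (N := N) hm hj
  have hle := chooseMin_card_le hmem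
  have hch := chooseMin_mem ⟨_, hmem⟩
  rw [card_finsetSeg] at hle
  generalize chooseMin _ = T at hle hch
  obtain ⟨hT, he, hs⟩ := mem_cands.1 hch
  rcases Multiset.mem_add.1 hT with hT | hT
  · obtain ⟨i, -, rfl⟩ := mem_staircase.1 hT
    rw [endg_finsetSeg _ hm] at he
    push_cast at he
    rw [show (i : ℝ) = j by linarith]
  · rcases hN.subset_or T hT _ hj he with h | ⟨-, h | h⟩
    · exact absurd h hs
    · omega
    · rw [h]
      push_cast
      rw [add_assoc]

theorem cands_eq_empty (hm : 1 ≤ m) (hN : NonInterfering b m r N) :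
    cands (staircase b m r + N) (b + (0 : ℕ) + m - 1) (prevSeg b m r 0) = ∅ := by
  rw [Finset.eq_empty_iff_forall_notMem]
  intro T hT
  obtain ⟨hT, he, hs⟩ := mem_cands.1 hT
  rcases Multiset.mem_add.1 hT with hT | hT
  · obtain ⟨i, -, rfl⟩ := mem_staircase.1 hT
    rw [endg_finsetSeg _ hm] at he
    have : (0 : ℝ) ≤ i := i.cast_nonneg
    push_cast at he
    linarith
  · rcases hN.subset_or T hT 0 (by omega) he with h | ⟨h, -⟩
    · exact hs h
    · omega

theorem mwChainAux_eq_descStair (hm : 1 ≤ m) (hN : NonInterfering b m r N) :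
    ∀ j ≤ r, ∀ n ≥ j, mwChainAux (staircase b m r + N) n (b + j + m - 1) (prevSeg b m r j) =
      descStair b m j
  | 0, _, 0, _ => rfl
  | 0, _, n + 1, _ => by
    rw [mwChainAux, cands_eq_empty hm hN]
    simp [descStair]
  | j + 1, hj, n + 1, hn => by
    rw [mwChainAux, if_pos ⟨_, step_mem_cands hm hj⟩, chooseMin_cands hm hN hj, descStair,
      ← mwChainAux_eq_descStair hm hN j (by omega) n (by omega), prevSeg,
      if_neg (by omega : j ≠ r)]
    congr 2
    push_cast
    ring

theorem maxEnd_step (hm : 1 ≤ m) (hr : 1 ≤ r) (hN : NonInterfering b m r N) :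
    maxEnd (staircase b m r + N) = b + r + m - 1 := by
  have hmax : ((staircase b m r + N).map endg).toFinset.max = ((b + r + m - 1 : ℝ) : WithBot ℝ) := by
    apply le_antisymm
    · apply Finset.max_le
      intro x hx
      obtain ⟨T, hT, rfl⟩ := Multiset.mem_map.1 (Multiset.mem_toFinset.1 hx)
      rw [WithBot.coe_le_coe]
      rcases Multiset.mem_add.1 hT with hT | hT
      · obtain ⟨i, hi, rfl⟩ := mem_staircase.1 hT
        rw [endg_finsetSeg _ hm]
        have : (i : ℝ) + 1 ≤ r := by exact_mod_cast hi
        linarith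
      · exact hN.endg_le T hT
    · apply Finset.le_max
      refine Multiset.mem_toFinset.2 (Multiset.mem_map.2
        ⟨finsetSeg (b + (r - 1 : ℕ) + 1) m, ?_, ?_⟩)
      · exact Multiset.mem_add.2 (.inl (mem_staircase.2 ⟨r - 1, by omega, rfl⟩))
      · rw [endg_finsetSeg _ hm, Nat.cast_sub hr]
        push_cast
        ring
  rw [maxEnd, hmax]
  rfl

theorem mwChain_step (hm : 1 ≤ m) (hr : 1 ≤ r) (hN : NonInterfering b m r N) :
    mwChain (staircase b m r + N) = descStair b m r := by
  rw [mwChain, maxEnd_step hm hr hN, ← mwChainAux_eq_descStair hm hN r le_rfl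
    (Multiset.card (staircase b m r + N)) (by simp [card_staircase]), prevSeg, if_pos rfl]

theorem firstSeg_step (hm : 1 ≤ m) (hr : 1 ≤ r) (hN : NonInterfering b m r N) :
    firstSeg (staircase b m r + N) = finsetSeg (b + m) r := by
  rw [firstSeg, mwChain_step hm hr hN, maxEnd_step hm hr hN, length_descStair, Nat.cast_sub hr]
  congr 1
  push_cast
  ring

end Step

/-- A staircase with its empty segments discarded. -/
def properStair (b : ℝ) (m r : ℕ) : Multiset (Finset ℝ) :=
  if m = 0 then 0 else staircase b m r

theorem properStair_of_pos (b : ℝ) {m : ℕ} (hm : 1 ≤ m) (r : ℕ) :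
    properStair b m r = staircase b m r :=
  if_neg (by omega)

theorem foldl_segMinus_descStair (b : ℝ) (m r : ℕ) (N : Multiset (Finset ℝ)) :
    (descStair b (m + 1) r).foldl
      (fun N δ => if segMinus δ = ∅ then N.erase δ else segMinus δ ::ₘ N.erase δ)
      (staircase b (m + 1) r + N) = properStair b m r + N := by
  induction r generalizing N with
  | zero => simp [descStair, properStair, staircase]
  | succ r ih =>
    rw [descStair, List.foldl_cons, segMinus_finsetSeg_succ, staircase_succ, Multiset.cons_add,
      Multiset.erase_cons_head]
    rcases Nat.eq_zero_or_pos m with rfl | hm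
    · rw [if_pos (finsetSeg_zero _), ih]
      simp [properStair]
    · rw [if_neg (finsetSeg_nonempty _ hm).ne_empty, ← Multiset.add_cons, ih,
        properStair_of_pos b hm, properStair_of_pos b hm, staircase_succ, Multiset.add_cons,
        Multiset.cons_add]

/-- One round of the Moeglin-Waldspurger algorithm peels off the endings of a whole staircase. -/
theorem mwaAux_step {b : ℝ} {m r : ℕ} {N : Multiset (Finset ℝ)} (hr : 1 ≤ r)
    (hN : NonInterfering b (m + 1) r N) (n : ℕ) :
    mwaAux (n + 1) (staircase b (m + 1) r + N) =
      finsetSeg (b + m + 1) r ::ₘ mwaAux n (properStair b m r + N) := by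
  have hne : staircase b (m + 1) r + N ≠ 0 := by
    rw [← Multiset.card_pos, Multiset.card_add, card_staircase]
    omega
  rw [mwaAux, if_neg hne, firstSeg_step (by omega) hr hN, msMinus, mwChain_step (by omega) hr hN,
    foldl_segMinus_descStair]
  push_cast
  rw [add_assoc]

theorem nonInterfering_long (a : ℝ) {k p q : ℕ} (hk : 2 ≤ k) (hp : 1 ≤ p)
    (hq : q = p ∨ q = p + 1) :
    NonInterfering (a - 1) p (k + 1) (properStair a q (k - 1)) := by
  have hq1 : 1 ≤ q := by omega
  rw [properStair_of_pos a hq1]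
  constructor
  · intro T hT
    obtain ⟨i, hi, rfl⟩ := mem_staircase.1 hT
    rw [endg_finsetSeg _ hq1]
    have : ((i + 1 + q : ℕ) : ℝ) ≤ (k + p : ℕ) := by exact_mod_cast (by omega)
    push_cast at this ⊢
    linarith
  · intro T hT j hj he
    obtain ⟨i, hi, rfl⟩ := mem_staircase.1 hT
    rw [endg_finsetSeg _ hq1] at he
    have hij : i + q + 2 = j + p := by
      have : ((i + q + 2 : ℕ) : ℝ) = (j + p : ℕ) := by
        push_cast
        linarith
      exact_mod_cast this
    refine .inr ⟨by omega, ?_⟩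
    rcases hq with rfl | rfl
    · right
      obtain rfl : j = i + 2 := by omega
      congr 1
      push_cast
      ring
    · left
      rw [card_finsetSeg]
      omega

theorem nonInterfering_short (a : ℝ) {k p q : ℕ} (hk : 2 ≤ k) (hpq : p = 0 ∨ q = p + 2) :
    NonInterfering a q (k - 1) (properStair (a - 1) p (k + 1)) := by
  rcases Nat.eq_zero_or_pos p with rfl | hp
  · constructor <;> simp [properStair]
  obtain rfl : q = p + 2 := by omega
  rw [properStair_of_pos _ hp]
  constructor
  · intro T hT
    obtain ⟨i, hi, rfl⟩ := mem_staircase.1 hT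
    rw [endg_finsetSeg _ hp]
    have : (i : ℝ) ≤ k := by exact_mod_cast (by omega)
    push_cast [Nat.cast_sub (by omega : 1 ≤ k)]
    linarith
  · intro T hT j hj he
    obtain ⟨i, hi, rfl⟩ := mem_staircase.1 hT
    rw [endg_finsetSeg _ hp] at he
    have hij : i = j + 2 := by
      have : (i : ℝ) = (j + 2 : ℕ) := by
        push_cast at he ⊢
        linarith
      exact_mod_cast this
    subst hij
    left
    rw [prevSeg, if_neg (by omega)]
    refine finsetSeg_subset 1 ?_ (by omega)
    push_cast
    ring

theorem mwaAux_properStair_add (a : ℝ) {k : ℕ} (hk : 2 ≤ k) (n : ℕ) :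
    ∀ p q : ℕ, (q = p ∨ q = p + 1 ∨ q = p + 2) → p + q ≤ n →
      mwaAux n (properStair a q (k - 1) + properStair (a - 1) p (k + 1)) =
        staircase a (k - 1) q + staircase (a - 1) (k + 1) p := by
  induction n with
  | zero =>
    intro p q _ h
    obtain ⟨rfl, rfl⟩ : p = 0 ∧ q = 0 := by omega
    simp [mwaAux, staircase]
  | succ n ih =>
    intro p q hpq hn
    by_cases hlong : 1 ≤ p ∧ q ≤ p + 1
    · obtain ⟨p, rfl⟩ : ∃ p', p = p' + 1 := ⟨p - 1, by omega⟩
      rw [properStair_of_pos (a - 1) (by omega), add_comm (properStair _ _ _),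
        mwaAux_step (by omega) (nonInterfering_long a hk (by omega) (by omega)),
        add_comm (properStair _ _ _), ih p q (by omega) (by omega), staircase_succ _ _ p,
        Multiset.add_cons]
    · rcases Nat.eq_zero_or_pos q with rfl | hq
      · obtain rfl : p = 0 := by omega
        simp [mwaAux, properStair, staircase]
      · obtain ⟨q, rfl⟩ : ∃ q', q = q' + 1 := ⟨q - 1, by omega⟩
        rw [properStair_of_pos a (by omega),
          mwaAux_step (by omega) (nonInterfering_short a hk (by omega)),
          ih p q (by omega) (by omega), staircase_succ _ _ q, Multiset.cons_add]

/-- `(M(c + 1/2; l, k-1) ⊎ M(c - 1/2; l, k+1))^# = M(c + 1/2; k-1, l) ⊎ M(c - 1/2; k+1, l)`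
for `l ≥ 1` and `k ≥ 2`. -/
theorem mwa_unbalanced_staircases (c : ℝ) (l k : ℕ) (hl : 1 ≤ l) (hk : 2 ≤ k) :
    mwa (staircase (c + 1/2) l (k - 1) + staircase (c - 1/2) l (k + 1)) =
      staircase (c + 1/2) (k - 1) l + staircase (c - 1/2) (k + 1) l := by
  have hfuel : l + l ≤ Multiset.card
      (suppM (staircase (c + 1/2) l (k - 1) + staircase (c - 1/2) l (k + 1))) := by
    rw [suppM_add, Multiset.card_add, card_suppM_staircase, card_suppM_staircase]
    exact add_le_add (Nat.le_mul_of_pos_left l (by omega)) (Nat.le_mul_of_pos_left l (by omega))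
  have h := mwaAux_properStair_add (c + 1/2) hk _ l l (.inl rfl) hfuel
  rwa [properStair_of_pos _ hl, properStair_of_pos _ hl,
    show c + 1/2 - 1 = c - 1/2 by ring] at h
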